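/- arXiv:0906.2848 — 2 statements merged into one kernel-verified Lean document; each statement's English description precedes it below -/
import Mathlib

section
/- If M is a positive integer with M ≡ 1 (mod 8), 3 | M and 3² ∤ M, then (1,6,6,0,0,0)(M) = 2·(2,3,6,0,0,0)(M) and (1,8,8,0,0,0)(M) = 2·(1,6,6,0,0,0)(M). -/
/-- The number of representations of `M` by the ternary quadratic form
`a x² + b y² + c z² + d y z + e z x + f x y`. -/
noncomputable def rep (a b c d e f M : ℤ) : ℕ :=
  {p : ℤ × ℤ × ℤ | M = a * p.1 ^ 2 + b * p.2.1 ^ 2 + c * p.2.2 ^ 2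
      + d * p.2.1 * p.2.2 + e * p.2.2 * p.1 + f * p.1 * p.2.1}.ncard

open Filter Topology


noncomputable def qP (p : ℝ) (n : ℕ) : ℝ := ∏ i ∈ Finset.range n, (1 - p ^ (i + 1))

noncomputable def gB (p : ℝ) : ℕ → ℕ → ℝ
  | _, 0 => 1
  | 0, _ + 1 => 0
  | n + 1, k + 1 => gB p n k + p ^ (k + 1) * gB p n (k + 1)

lemma gB_zero_right (p : ℝ) (n : ℕ) : gB p n 0 = 1 := by cases n <;> simp [gB]

lemma gB_of_lt (p : ℝ) : ∀ n k : ℕ, n < k → gB p n k = 0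
  | 0, 0, h => by omega
  | 0, k + 1, _ => by simp [gB]
  | n + 1, 0, h => by omega
  | n + 1, k + 1, h => by
    simp [gB, gB_of_lt p n k (by omega), gB_of_lt p n (k + 1) (by omega)]

lemma gB_mul (p : ℝ) : ∀ n k l : ℕ, k + l = n → gB p n k * qP p k * qP p l = qP p n
  | 0, k, l, h => by
    obtain rfl : k = 0 := by omega
    obtain rfl : l = 0 := by omega
    simp [gB, qP]
  | n + 1, 0, l, h => by
    obtain rfl : l = n + 1 := by omega
    simp [gB, qP]
  | n + 1, k + 1, 0, h => by
    obtain rfl : n = k := by omega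
    have h1 := gB_mul p n n 0 (by omega)
    simp only [gB, gB_of_lt p n (n + 1) (by omega)]
    simp only [qP, Finset.prod_range_succ, Finset.prod_range_zero] at *
    linear_combination (1 - p ^ (n + 1)) * h1
  | n + 1, k + 1, l + 1, h => by
    have h1 := gB_mul p n k (l + 1) (by omega)
    have h2 := gB_mul p n (k + 1) l (by omega)
    simp only [gB]
    generalize gB p n k = g1 at *
    generalize gB p n (k + 1) = g2 at *
    obtain rfl : n = k + l + 1 := by omega
    simp only [qP, Finset.prod_range_succ] at *
    linear_combination (1 - p ^ (k + 1)) * h1 + p ^ (k + 1) * (1 - p ^ (l + 1)) * h2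

lemma rothe (p : ℝ) (N : ℕ) : ∀ x : ℝ, ∏ k ∈ Finset.range N, (1 + x * p ^ k) =
    ∑ i ∈ Finset.range (N + 1), gB p N i * p ^ (i.choose 2) * x ^ i := by
  induction N with
  | zero => intro x; simp [gB]
  | succ N ih =>
    intro x
    rw [Finset.prod_range_succ']
    have h1 : ∏ k ∈ Finset.range N, (1 + x * p ^ (k + 1)) =
        ∏ k ∈ Finset.range N, (1 + (x * p) * p ^ k) :=
      Finset.prod_congr rfl fun k _ => by ring
    rw [h1, ih, Finset.sum_range_succ' _ (N + 1)]
    simp only [gB]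
    have h2 : ∑ i ∈ Finset.range (N + 1), (gB p N i + p ^ (i + 1) * gB p N (i + 1)) *
        p ^ ((i + 1).choose 2) * x ^ (i + 1) =
        x * ∑ i ∈ Finset.range (N + 1), gB p N i * p ^ (i.choose 2) * (x * p) ^ i +
        ∑ i ∈ Finset.range (N + 1), gB p N (i + 1) * p ^ ((i + 1).choose 2) * (x * p) ^ (i + 1) := by
      rw [Finset.mul_sum, ← Finset.sum_add_distrib]
      refine Finset.sum_congr rfl fun i _ => ?_
      have : (i + 1).choose 2 = i + i.choose 2 := by
        rw [Nat.choose_succ_succ' i 1]; simp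
      rw [this]; ring
    rw [h2]
    have h3 : ∑ i ∈ Finset.range (N + 1), gB p N (i + 1) * p ^ ((i + 1).choose 2) * (x * p) ^ (i + 1)
        = ∑ i ∈ Finset.range (N + 1), gB p N i * p ^ (i.choose 2) * (x * p) ^ i - 1 := by
      rw [Finset.sum_range_succ, gB_of_lt p N (N + 1) (by omega), Finset.sum_range_succ' _ N]
      simp [gB_zero_right]
    rw [h3]; simp; ring

/-- the exponent -/
def ex (r s : ℕ) (j : ℤ) : ℕ := (((r : ℤ) + s) * (j * (j - 1) / 2) + r * j).toNat

lemma ex_two (r s : ℕ) (hr : 0 < r) (hs : 0 < s) (j : ℤ) :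
    2 * (ex r s j : ℤ) = (r + s) * (j * (j - 1)) + 2 * r * j ∧ |j| ≤ (ex r s j : ℤ) := by
  have hE : 2 * (j * (j - 1) / 2) = j * (j - 1) := by
    apply Int.mul_ediv_cancel'
    rcases Int.even_or_odd j with h | h
    · exact Dvd.dvd.mul_right h.two_dvd _
    · exact Dvd.dvd.mul_left (h.sub_odd odd_one).two_dvd _
  set E := j * (j - 1) / 2 with hEd
  have hr' : (1 : ℤ) ≤ r := by exact_mod_cast hr
  have hs' : (1 : ℤ) ≤ s := by exact_mod_cast hs
  have key : |j| ≤ ((r : ℤ) + s) * E + r * j := by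
    have h0 : (0 : ℤ) ≤ E := by
      rcases le_or_gt j 0 with h | h <;> nlinarith
    have h1 : (0 : ℤ) ≤ E + j := by
      rcases le_or_gt j (-1) with h | h
      · nlinarith
      · rcases (show j = 0 ∨ 1 ≤ j by omega) with rfl | h
        · linarith
        · linarith
    have h2 : ((r : ℤ) + s) * E + r * j = r * (E + j) + s * E := by ring
    have h3 : (E + j) + E ≤ r * (E + j) + s * E := by nlinarith
    have h4 : |j| ≤ (E + j) + E := by
      have : (E + j) + E = j * j := by linarith
      rw [this]
      rcases abs_cases j with ⟨h, _⟩ | ⟨h, _⟩ <;> rw [h] <;> nlinarith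
    linarith
  have hn : (ex r s j : ℤ) = ((r : ℤ) + s) * E + r * j := by
    unfold ex
    rw [Int.toNat_of_nonneg ((abs_nonneg j).trans key)]
  rw [hn]
  exact ⟨by linear_combination ((r : ℤ) + s) * hE, key⟩

lemma finite_jtp (q : ℝ) (hq : 0 < q) (r s : ℕ) (hr : 0 < r) (hs : 0 < s) (n : ℕ) :
    (∏ k ∈ Finset.range n, (1 + q ^ (r + (r + s) * k))) *
    (∏ k ∈ Finset.range n, (1 + q ^ (s + (r + s) * k))) =
    ∑ i ∈ Finset.range (2 * n + 1), gB (q ^ (r + s)) (2 * n) i * q ^ (ex r s ((i : ℤ) - n)) := by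
  have hq0 : q ≠ 0 := hq.ne'
  set p := q ^ (r + s) with hp
  have hp0 : p ≠ 0 := pow_ne_zero _ hq0
  have h := rothe p (2 * n) (q ^ r * (p ^ n)⁻¹)
  rw [two_mul, Finset.prod_range_add] at h
  have h1 : ∏ k ∈ Finset.range n, (1 + q ^ r * (p ^ n)⁻¹ * p ^ (n + k)) =
      ∏ k ∈ Finset.range n, (1 + q ^ (r + (r + s) * k)) := by
    refine Finset.prod_congr rfl fun k _ => ?_
    rw [pow_add q r, pow_mul, ← hp, pow_add]; field_simp
  have h2 : ∀ n : ℕ, ∏ k ∈ Finset.range n, (1 + q ^ r * (p ^ n)⁻¹ * p ^ k) =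
      (q ^ (ex r s (-(n:ℤ))))⁻¹ * ∏ k ∈ Finset.range n, (1 + q ^ (s + (r + s) * k)) := by
    intro n
    induction n with
    | zero => simp [ex]
    | succ n ih =>
      rw [Finset.prod_range_succ']
      have : ∏ k ∈ Finset.range n, (1 + q ^ r * (p ^ (n + 1))⁻¹ * p ^ (k + 1)) =
        ∏ k ∈ Finset.range n, (1 + q ^ r * (p ^ n)⁻¹ * p ^ k) := by
          refine Finset.prod_congr rfl fun k _ => ?_
          rw [pow_succ, pow_succ]; field_simp
      rw [this, ih, Finset.prod_range_succ]
      have e1 := (ex_two r s hr hs (-(n:ℤ))).1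
      have e2 := (ex_two r s hr hs (-((n+1 : ℕ):ℤ))).1
      have e3 : ex r s (-((n+1 : ℕ):ℤ)) = ex r s (-(n:ℤ)) + (s + (r + s) * n) := by
        zify
        push_cast at e2 ⊢
        linarith
      rw [e3, pow_add q]
      have : 1 + q ^ r * (p ^ (n + 1))⁻¹ * p ^ 0 = (q ^ (s + (r + s) * n))⁻¹ * (1 + q ^ (s + (r + s) * n)) := by
        have e4 : p ^ (n + 1) = q ^ r * q ^ (s + (r + s) * n) := by
          rw [hp, ← pow_mul, ← pow_add]; congr 1; ring
        rw [e4]; field_simp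
        ring
      rw [this, mul_inv]; ring
  rw [h1, h2] at h
  have h3 : (q ^ (ex r s (-(n:ℤ)))) ≠ 0 := pow_ne_zero _ hq0
  have h4 : (∏ k ∈ Finset.range n, (1 + q ^ (r + (r + s) * k))) *
    (∏ k ∈ Finset.range n, (1 + q ^ (s + (r + s) * k))) = (q ^ (ex r s (-(n:ℤ)))) *
     ((q ^ (ex r s (-(n:ℤ))))⁻¹ * (∏ k ∈ Finset.range n, (1 + q ^ (s + (r + s) * k))) *
      ∏ k ∈ Finset.range n, (1 + q ^ (r + (r + s) * k))) := by field_simp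
  rw [h4, h, two_mul, Finset.mul_sum]
  refine Finset.sum_congr rfl fun i _ => ?_
  have e1 := (ex_two r s hr hs (-(n:ℤ))).1
  have e2 := (ex_two r s hr hs ((i:ℤ) - n)).1
  have e5 : 2 * ((i.choose 2 : ℕ) : ℤ) = i * (i - 1) := by
    rw [Nat.choose_two_right]
    have := Nat.two_mul_div_two_of_even (Nat.even_mul_pred_self i)
    zify at this
    push_cast
    rw [this]
    rcases i with _ | i <;> simp
  have e6 : ex r s ((i:ℤ) - n) + (r + s) * (n * i) = ex r s (-(n:ℤ)) + (r + s) * i.choose 2 + r * i := by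
    zify
    have : (2:ℤ) ≠ 0 := by norm_num
    apply mul_left_cancel₀ this
    linear_combination e2 - e1 - (r + s) * e5
  have e7 : q ^ ex r s ((i:ℤ) - n) * (p ^ n) ^ i = q ^ ex r s (-(n:ℤ)) * p ^ (i.choose 2) * (q ^ r) ^ i := by
    rw [hp]; simp only [← pow_mul, ← pow_add]; congr 1; rw [mul_assoc]; exact e6
  have h5 : (p ^ n) ^ i ≠ 0 := by positivity
  rw [mul_pow, inv_pow]
  field_simp
  linear_combination - gB p (n + n) i * e7



noncomputable def Dk (q : ℝ) (k : ℕ) : ℝ := ∏' n : ℕ, (1 - q ^ (k * (n + 1)))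
noncomputable def Ak (q : ℝ) (r c : ℕ) : ℝ := ∏' n : ℕ, (1 + q ^ (r + c * n))

lemma summ_pow (q : ℝ) (h0 : 0 < q) (h1 : q < 1) (r c : ℕ) (hc : 0 < c) :
    Summable fun n : ℕ => q ^ (r + c * n) := by
  simp_rw [pow_add, pow_mul]
  exact (summable_geometric_of_lt_one (by positivity) (pow_lt_one₀ h0.le h1 hc.ne')).mul_left _

lemma mult_A (q : ℝ) (h0 : 0 < q) (h1 : q < 1) (r c : ℕ) (hc : 0 < c) :
    Multipliable fun n : ℕ => (1 + q ^ (r + c * n)) :=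
  Real.multipliable_one_add_of_summable (summ_pow q h0 h1 r c hc)

lemma mult_D (q : ℝ) (h0 : 0 < q) (h1 : q < 1) (k : ℕ) (hc : 0 < k) :
    Multipliable fun n : ℕ => (1 - q ^ (k * (n + 1))) := by
  simp_rw [sub_eq_add_neg]
  refine Real.multipliable_one_add_of_summable (Summable.neg ?_)
  exact (summ_pow q h0 h1 k k hc).congr fun n => by rw [Nat.mul_succ, add_comm]

lemma D_ne (q : ℝ) (h0 : 0 < q) (h1 : q < 1) (k : ℕ) (hc : 0 < k) : Dk q k ≠ 0 := by
  unfold Dk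
  simp_rw [sub_eq_add_neg]
  apply tprod_one_add_ne_zero_of_summable
  · intro n
    have : q ^ (k * (n + 1)) < 1 := pow_lt_one₀ h0.le h1 (by positivity)
    linarith
  · have := summ_pow q h0 h1 k k hc
    simp only [norm_neg]
    refine Summable.norm ?_
    exact this.congr fun n => by rw [Nat.mul_succ, add_comm]

lemma A_split2 (q : ℝ) (h0 : 0 < q) (h1 : q < 1) (r c : ℕ) (hc : 0 < c) :
    Ak q r c = Ak q r (2 * c) * Ak q (r + c) (2 * c) := by
  unfold Ak
  rw [← tprod_even_mul_odd (f := fun n => 1 + q ^ (r + c * n))]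
  · congr 1 <;> refine tprod_congr fun n => ?_ <;> congr 2 <;> ring
  · convert mult_A q h0 h1 r (2 * c) (by omega) using 4; ring
  · convert mult_A q h0 h1 (r + c) (2 * c) (by omega) using 4; ring

lemma A_split3 (q : ℝ) (h0 : 0 < q) (h1 : q < 1) (r c : ℕ) (hc : 0 < c) :
    Ak q r c = Ak q r (3 * c) * Ak q (r + c) (3 * c) * Ak q (r + 2 * c) (3 * c) := by
  unfold Ak
  have t0 := (mult_A q h0 h1 r c hc).hasProd.tendsto_prod_nat
  have t1 := (mult_A q h0 h1 r (3 * c) (by omega)).hasProd.tendsto_prod_nat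
  have t2 := (mult_A q h0 h1 (r + c) (3 * c) (by omega)).hasProd.tendsto_prod_nat
  have t3 := (mult_A q h0 h1 (r + 2 * c) (3 * c) (by omega)).hasProd.tendsto_prod_nat
  have t4 : Tendsto (fun n : ℕ => 3 * n) atTop atTop :=
    tendsto_id.const_mul_atTop' (by norm_num)
  refine tendsto_nhds_unique (t0.comp t4) (((t1.mul t2).mul t3).congr fun n => ?_)
  simp only [Function.comp]
  induction n with
  | zero => simp
  | succ n ih =>
    rw [show 3 * (n + 1) = 3 * n + 1 + 1 + 1 by ring]
    simp only [Finset.prod_range_succ]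
    rw [← ih]
    rw [show r + c * (3 * n) = r + 3 * c * n by ring,
      show r + c * (3 * n + 1) = r + c + 3 * c * n by ring,
      show r + c * (3 * n + 1 + 1) = r + 2 * c + 3 * c * n by ring]
    ring

lemma D_double (q : ℝ) (h0 : 0 < q) (h1 : q < 1) (k : ℕ) (hc : 0 < k) :
    Dk q (2 * k) = Dk q k * Ak q k k := by
  unfold Ak Dk
  rw [← (mult_D q h0 h1 k hc).tprod_mul (mult_A q h0 h1 k k hc)]
  refine tprod_congr fun n => ?_
  rw [show 2 * k * (n + 1) = k * (n + 1) + k * (n + 1) by ring,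
    show k + k * n = k * (n + 1) by ring, pow_add]
  ring

lemma summ_ex (q : ℝ) (h0 : 0 < q) (h1 : q < 1) (r s : ℕ) (hr : 0 < r) (hs : 0 < s) :
    Summable fun j : ℤ => q ^ ex r s j := by
  refine Summable.of_nonneg_of_le (f := fun j : ℤ => q ^ j.natAbs) (fun j => by positivity) (fun j => ?_) ?_
  · apply pow_le_pow_of_le_one h0.le h1.le
    have := (ex_two r s hr hs j).2
    rw [Int.abs_eq_natAbs] at this
    omega
  · apply Summable.of_nat_of_neg <;> simpa using summable_geometric_of_lt_one h0.le h1

lemma jtp (q : ℝ) (h0 : 0 < q) (h1 : q < 1) (r s : ℕ) (hr : 0 < r) (hs : 0 < s) :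
    ∑' j : ℤ, q ^ ex r s j = Dk q (r + s) * Ak q r (r + s) * Ak q s (r + s) := by
  have hc : 0 < r + s := by omega
  have hD := D_ne q h0 h1 (r + s) hc
  set p := q ^ (r + s) with hp
  have hp0 : 0 < p := by positivity
  have hp1 : p < 1 := pow_lt_one₀ h0.le h1 hc.ne'
  have tQ : Tendsto (qP p) atTop (𝓝 (Dk q (r + s))) := by
    have := (mult_D q h0 h1 (r + s) hc).hasProd.tendsto_prod_nat
    refine this.congr fun n => ?_
    unfold qP
    simp_rw [hp, ← pow_mul]
  have hQpos : ∀ n, 0 < qP p n := fun n => Finset.prod_pos fun i _ => by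
    have : p ^ (i + 1) < 1 := pow_lt_one₀ hp0.le hp1 (by omega)
    linarith
  have hQanti : Antitone (qP p) := antitone_nat_of_succ_le fun n => by
    have e : qP p (n + 1) = qP p n * (1 - p ^ (n + 1)) := by simp [qP, Finset.prod_range_succ]
    have : 0 < p ^ (n + 1) := by positivity
    have := hQpos n
    rw [e]; nlinarith
  have hQge : ∀ n, Dk q (r + s) ≤ qP p n := fun n => hQanti.le_of_tendsto tQ n
  have hQle : ∀ n, qP p n ≤ 1 := fun n => by
    have := hQanti (Nat.zero_le n); simpa [qP] using this
  have hDpos : 0 < Dk q (r + s) :=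
    lt_of_le_of_ne (ge_of_tendsto' tQ fun n => (hQpos n).le) hD.symm
  set F : ℕ → ℤ → ℝ := fun n j =>
    if |j| ≤ n then gB p (2 * n) (j + n).toNat * q ^ ex r s j else 0 with hF
  have hgB : ∀ (n : ℕ) (j : ℤ), |j| ≤ n → gB p (2 * n) (j + n).toNat =
      qP p (2 * n) / (qP p (j + n).toNat * qP p (n - j).toNat) := by
    intro n j hj
    rw [abs_le] at hj
    have := gB_mul p (2 * n) (j + n).toNat (n - j).toNat (by omega)
    have h2 := (hQpos (j + n).toNat).ne'
    have h3 := (hQpos (n - j).toNat).ne'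
    field_simp
    linarith
  have hsum : ∀ n, ∑' j, F n j = (∏ k ∈ Finset.range n, (1 + q ^ (r + (r + s) * k))) *
      (∏ k ∈ Finset.range n, (1 + q ^ (s + (r + s) * k))) := by
    intro n
    rw [finite_jtp q h0 r s hr hs n]
    let em : ℕ ↪ ℤ := ⟨fun i => (i : ℤ) - n, fun a b h => by simpa using h⟩
    rw [tsum_eq_sum (s := (Finset.range (2 * n + 1)).map em), Finset.sum_map]
    · refine Finset.sum_congr rfl fun i hi => ?_
      have hi' := Finset.mem_range.1 hi
      have : |(i : ℤ) - n| ≤ n := by rw [abs_le]; omega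
      have e0 : em i = (i : ℤ) - n := rfl
      simp only [hF, e0, if_pos this, sub_add_cancel, Int.toNat_natCast]
      rfl
    · intro j hj
      simp only [hF]
      rw [if_neg]
      intro h
      rw [abs_le] at h
      apply hj
      simp only [Finset.mem_map, Finset.mem_range]
      exact ⟨(j + n).toNat, by omega, by change (((j + n).toNat : ℕ) : ℤ) - n = j; omega⟩
  have lim1 : Tendsto (fun n => ∑' j, F n j) atTop
      (𝓝 (∑' j, (Dk q (r + s))⁻¹ * q ^ ex r s j)) := by
    refine tendsto_tsum_of_dominated_convergence
      (bound := fun j => (Dk q (r + s) * Dk q (r + s))⁻¹ * q ^ ex r s j)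
      ((summ_ex q h0 h1 r s hr hs).mul_left _) (fun j => ?_) (Eventually.of_forall fun n j => ?_)
    · have c1 : Tendsto (fun n : ℕ => (j + n).toNat) atTop atTop :=
        tendsto_atTop.2 fun b => (eventually_ge_atTop (b + j.natAbs)).mono fun n hn => by omega
      have c2 : Tendsto (fun n : ℕ => ((n : ℤ) - j).toNat) atTop atTop :=
        tendsto_atTop.2 fun b => (eventually_ge_atTop (b + j.natAbs)).mono fun n hn => by omega
      have c3 : Tendsto (fun n : ℕ => 2 * n) atTop atTop :=
        tendsto_id.const_mul_atTop' (by norm_num)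
      have := ((tQ.comp c3).div ((tQ.comp c1).mul (tQ.comp c2)) (mul_ne_zero hD hD)).mul_const
        (q ^ ex r s j)
      have e : Dk q (r + s) / (Dk q (r + s) * Dk q (r + s)) = (Dk q (r + s))⁻¹ := by field_simp
      rw [e] at this
      refine this.congr' ((eventually_ge_atTop j.natAbs).mono fun n hn => ?_)
      have hj : |j| ≤ n := by rw [Int.abs_eq_natAbs]; omega
      simp only [hF, if_pos hj, hgB n j hj, Pi.div_apply, Function.comp]
    · simp only [hF]
      split_ifs with hj
      · rw [norm_mul, hgB n j hj]
        have a1 := hQpos (j + n).toNat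
        have a2 := hQpos (n - j).toNat
        rw [Real.norm_of_nonneg (by positivity : (0 : ℝ) ≤ q ^ ex r s j),
          Real.norm_of_nonneg (div_nonneg (hQpos _).le (by positivity))]
        gcongr
        rw [← one_div]
        exact div_le_div₀ zero_le_one (hQle _) (by positivity)
          (mul_le_mul (hQge _) (hQge _) hDpos.le a1.le)
      · simp only [norm_zero]; positivity
  simp_rw [hsum] at lim1
  have lim2 := (mult_A q h0 h1 r (r + s) hc).hasProd.tendsto_prod_nat.mul
    (mult_A q h0 h1 s (r + s) hc).hasProd.tendsto_prod_nat
  have := tendsto_nhds_unique lim1 lim2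
  rw [tsum_mul_left] at this
  unfold Ak
  rw [mul_assoc, ← this]
  field_simp

lemma theta_id1 (q : ℝ) (h0 : 0 < q) (h1 : q < 1) :
    (∑' j : ℤ, q ^ ex 3 1 j) * (∑' j : ℤ, q ^ ex 5 1 j) * (∑' j : ℤ, q ^ ex 3 3 j) =
    (∑' j : ℤ, q ^ ex 9 3 j) * (∑' j : ℤ, q ^ ex 4 2 j) * (∑' j : ℤ, q ^ ex 1 1 j) := by
  rw [jtp q h0 h1 3 1, jtp q h0 h1 5 1, jtp q h0 h1 3 3, jtp q h0 h1 9 3, jtp q h0 h1 4 2,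
    jtp q h0 h1 1 1] <;> try norm_num
  have a1 := A_split2 q h0 h1 1 2 (by norm_num)
  have a2 := A_split3 q h0 h1 1 2 (by norm_num)
  have a3 := A_split2 q h0 h1 3 6 (by norm_num)
  have a4 := D_double q h0 h1 2 (by norm_num)
  have a5 := A_split3 q h0 h1 2 2 (by norm_num)
  have a6 := D_double q h0 h1 6 (by norm_num)
  norm_num at a1 a2 a3 a4 a5 a6
  calc _ = (Ak q 1 4 * Ak q 3 4) * (Ak q 1 6 * Ak q 3 6 * Ak q 5 6) * Dk q 4 * Dk q 6 * Dk q 6 * Ak q 3 6 := by ring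
    _ = _ := by
      rw [← a1, ← a2, a4, a6, a5, a3]; ring

lemma theta_id2 (q : ℝ) (h0 : 0 < q) (h1 : q < 1) :
    (∑' j : ℤ, q ^ ex 3 1 j) * (∑' j : ℤ, q ^ ex 5 1 j) * (∑' j : ℤ, q ^ ex 5 1 j) =
    (∑' j : ℤ, q ^ ex 2 1 j) * (∑' j : ℤ, q ^ ex 18 6 j) * (∑' j : ℤ, q ^ ex 1 1 j) := by
  rw [jtp q h0 h1 3 1, jtp q h0 h1 5 1, jtp q h0 h1 2 1, jtp q h0 h1 18 6,
    jtp q h0 h1 1 1] <;> try norm_num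
  have a1 := A_split2 q h0 h1 1 2 (by norm_num)
  have a2 := A_split3 q h0 h1 1 2 (by norm_num)
  have a3 := A_split2 q h0 h1 6 12 (by norm_num)
  have a4 := D_double q h0 h1 2 (by norm_num)
  have a5 := A_split3 q h0 h1 1 1 (by norm_num)
  have a6 := D_double q h0 h1 6 (by norm_num)
  have a7 := D_double q h0 h1 12 (by norm_num)
  have a8 := D_double q h0 h1 3 (by norm_num)
  have a9 := A_split2 q h0 h1 1 1 (by norm_num)
  have b1 := A_split2 q h0 h1 3 3 (by norm_num)
  have b2 := A_split2 q h0 h1 6 6 (by norm_num)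
  norm_num at a1 a2 a3 a4 a5 a6 a7 a8 a9 b1 b2
  have k1 : Ak q 1 3 * Ak q 2 3 * Ak q 3 3 = Ak q 1 2 * Ak q 2 2 := by rw [← a5, a9]
  calc _ = (Ak q 1 4 * Ak q 3 4) * Dk q 4 * Dk q 6 ^ 2 * Ak q 5 6 ^ 2 * Ak q 1 6 ^ 2 := by ring
    _ = Ak q 1 2 * (Dk q 2 * Ak q 2 2) * Dk q 6 * (Dk q 3 * Ak q 3 3) * Ak q 5 6 ^ 2 * Ak q 1 6 ^ 2 := by
      rw [← a1, a4, ← a8]; ring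
    _ = Ak q 1 2 * (Ak q 1 6 * Ak q 3 6 * Ak q 5 6) * Ak q 2 2 * Dk q 2 * Dk q 6 * Dk q 3 * Ak q 6 6 *
        (Ak q 5 6 * Ak q 1 6) := by rw [b1]; ring
    _ = Ak q 1 2 * (Ak q 1 2 * Ak q 2 2) * Dk q 2 * Dk q 6 * Dk q 3 * Ak q 6 6 * (Ak q 5 6 * Ak q 1 6) := by
      rw [← a2]; ring
    _ = Ak q 1 2 * Ak q 1 3 * Ak q 2 3 * Dk q 2 * Dk q 6 * Dk q 3 * Ak q 6 6 *
      (Ak q 1 6 * Ak q 3 6 * Ak q 5 6) * Ak q 6 6 := by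
      rw [← k1, b1]; ring
    _ = Ak q 1 2 * Ak q 1 3 * Ak q 2 3 * Dk q 2 * Dk q 6 * Dk q 3 * Ak q 6 6 *
      Ak q 1 2 * (Ak q 6 12 * Ak q 12 12) := by rw [← a2, ← b2]
    _ = _ := by rw [a7, a6, a3]; ring


lemma my_hasSum_congr {ι : Type} {f g : ι → ℝ} {a : ℝ} (h : ∀ i, f i = g i) :
    HasSum f a ↔ HasSum g a := by rw [funext h]

lemma coeff_zero (b : ℕ → ℝ)
    (h : ∀ q : ℝ, 0 < q → q < 1 → HasSum (fun m => b m * q ^ m) 0) : ∀ m, b m = 0 := by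
  intro m
  induction m using Nat.strong_induction_on with
  | _ m ih =>
    have hs : ∀ q : ℝ, 0 < q → q < 1 → HasSum (fun k => b (k + m) * q ^ k) 0 := by
      intro q h0 h1
      have h2 := (hasSum_nat_add_iff' m).2 (h q h0 h1)
      rw [Finset.sum_eq_zero (fun i hi => by rw [ih i (Finset.mem_range.1 hi), zero_mul]),
        sub_zero] at h2
      have h3 := h2.mul_left ((q ^ m)⁻¹)
      rw [mul_zero] at h3
      refine (my_hasSum_congr fun k => ?_).2 h3
      rw [pow_add]; field_simp
    have ht : Tendsto (fun q : ℝ => ∑' k, b (k + m) * q ^ k) (𝓝[>] 0)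
        (𝓝 (∑' k, b (k + m) * 0 ^ k)) := by
      refine tendsto_tsum_of_dominated_convergence
        (bound := fun k => ‖b (k + m) * (1 / 2 : ℝ) ^ k‖) ?_ (fun k => ?_) ?_
      · exact (hs (1 / 2) (by norm_num) (by norm_num)).summable.norm
      · refine Tendsto.mono_left (Continuous.tendsto ?_ _) nhdsWithin_le_nhds
        fun_prop
      · filter_upwards [Ioo_mem_nhdsGT (show (0 : ℝ) < 1 / 2 by norm_num)] with q hq k
        rw [norm_mul, norm_mul]
        gcongr
        rw [Real.norm_of_nonneg (pow_nonneg hq.1.le _), Real.norm_of_nonneg (by positivity)]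
        exact pow_le_pow_left₀ hq.1.le hq.2.le _
    have ht2 : Tendsto (fun q : ℝ => ∑' k, b (k + m) * q ^ k) (𝓝[>] 0) (𝓝 0) := by
      refine tendsto_const_nhds.congr' ?_
      filter_upwards [Ioo_mem_nhdsGT (show (0 : ℝ) < 1 / 2 by norm_num)] with q hq
      exact (hs q hq.1 (by linarith [hq.2])).tsum_eq.symm
    have := tendsto_nhds_unique ht ht2
    rw [tsum_eq_single 0 (fun k hk => by simp [hk])] at this
    simpa using this

lemma card_eq_of_tsum {ι κ : Type} (E : ι → ℕ) (F : κ → ℕ)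
    (hE : ∀ q : ℝ, 0 < q → q < 1 → Summable fun i => q ^ E i)
    (hF : ∀ q : ℝ, 0 < q → q < 1 → Summable fun i => q ^ F i)
    (h : ∀ q : ℝ, 0 < q → q < 1 → ∑' i, q ^ E i = ∑' i, q ^ F i) (m : ℕ) :
    Nat.card {i // E i = m} = Nat.card {i // F i = m} := by
  have key : ∀ {ι : Type} (E : ι → ℕ) (q : ℝ) (_ : Summable fun i => q ^ E i),
      HasSum (fun m => (Nat.card {i // E i = m} : ℝ) * q ^ m) (∑' i, q ^ E i) := by
    intro ι E q hs
    have := hs.hasSum.tsum_fiberwise E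
    refine (my_hasSum_congr fun m => ?_).2 this
    have e : ∀ b : (E ⁻¹' {m} : Set ι), q ^ E b = q ^ m := fun b => by
      rw [show E b = m from b.2]
    rw [tsum_congr e, tsum_const, nsmul_eq_mul]
    rfl
  have := coeff_zero (fun m => (Nat.card {i // E i = m} : ℝ) - Nat.card {i // F i = m}) (by
    intro q h0 h1
    have a := (key E q (hE q h0 h1)).sub (key F q (hF q h0 h1))
    rw [h q h0 h1, sub_self] at a
    refine (my_hasSum_congr fun m => ?_).2 a
    ring) m
  have := sub_eq_zero.1 this
  exact_mod_cast this

/-- triple exponent -/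
def ex3 (a b c d e f : ℕ) (v : ℤ × ℤ × ℤ) : ℕ := ex a b v.1 + (ex c d v.2.1 + ex e f v.2.2)

lemma ex3_sum (q : ℝ) (h0 : 0 < q) (h1 : q < 1) (a b c d e f : ℕ) (ha : 0 < a) (hb : 0 < b)
    (hc : 0 < c) (hd : 0 < d) (he : 0 < e) (hf : 0 < f) :
    HasSum (fun v => q ^ ex3 a b c d e f v)
      ((∑' j : ℤ, q ^ ex a b j) * (∑' j : ℤ, q ^ ex c d j) * (∑' j : ℤ, q ^ ex e f j)) := by
  have s1 := summ_ex q h0 h1 a b ha hb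
  have s2 := summ_ex q h0 h1 c d hc hd
  have s3 := summ_ex q h0 h1 e f he hf
  have s23 := s2.mul_of_nonneg s3 (fun _ => by positivity) (fun _ => by positivity)
  have s123 := s1.mul_of_nonneg s23 (fun _ => by positivity) (fun _ => by simp only [Pi.zero_apply]; positivity)
  have := s1.hasSum.mul (s2.hasSum.mul s3.hasSum s23) s123
  rw [mul_assoc]
  refine (my_hasSum_congr fun v => ?_).2 this
  simp only [ex3, pow_add]

lemma count1 (m : ℕ) : Nat.card {v // ex3 3 1 5 1 3 3 v = m} = Nat.card {v // ex3 9 3 4 2 1 1 v = m} := by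
  refine card_eq_of_tsum _ _ (fun q h0 h1 => (ex3_sum q h0 h1 _ _ _ _ _ _ ?_ ?_ ?_ ?_ ?_ ?_).summable)
    (fun q h0 h1 => (ex3_sum q h0 h1 _ _ _ _ _ _ ?_ ?_ ?_ ?_ ?_ ?_).summable) (fun q h0 h1 => ?_) m
  all_goals try norm_num
  rw [(ex3_sum q h0 h1 _ _ _ _ _ _ _ _ _ _ _ _).tsum_eq, (ex3_sum q h0 h1 _ _ _ _ _ _ _ _ _ _ _ _).tsum_eq]
  · exact theta_id1 q h0 h1
  all_goals norm_num

lemma count2 (m : ℕ) : Nat.card {v // ex3 3 1 5 1 5 1 v = m} = Nat.card {v // ex3 2 1 18 6 1 1 v = m} := by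
  refine card_eq_of_tsum _ _ (fun q h0 h1 => (ex3_sum q h0 h1 _ _ _ _ _ _ ?_ ?_ ?_ ?_ ?_ ?_).summable)
    (fun q h0 h1 => (ex3_sum q h0 h1 _ _ _ _ _ _ ?_ ?_ ?_ ?_ ?_ ?_).summable) (fun q h0 h1 => ?_) m
  all_goals try norm_num
  rw [(ex3_sum q h0 h1 _ _ _ _ _ _ _ _ _ _ _ _).tsum_eq, (ex3_sum q h0 h1 _ _ _ _ _ _ _ _ _ _ _ _).tsum_eq]
  · exact theta_id2 q h0 h1
  all_goals norm_num


lemma sqmod8 (x : ℤ) : (x % 2 = 1 ∧ x ^ 2 % 8 = 1) ∨ (x % 4 = 2 ∧ x ^ 2 % 8 = 4) ∨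
    (x % 4 = 0 ∧ x ^ 2 % 8 = 0) := by
  have h : x % 8 = 0 ∨ x % 8 = 1 ∨ x % 8 = 2 ∨ x % 8 = 3 ∨ x % 8 = 4 ∨ x % 8 = 5 ∨ x % 8 = 6 ∨
    x % 8 = 7 := by omega
  rcases h with h | h | h | h | h | h | h | h <;>
    (have h2 := Int.mul_emod x x 8; rw [h, ← pow_two] at h2; norm_num at h2; omega)

lemma sqmod3 (x : ℤ) : (x % 3 = 0 ∧ x ^ 2 % 9 = 0) ∨ (x % 3 ≠ 0 ∧ x ^ 2 % 3 = 1) := by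
  have h : x % 3 = 0 ∨ x % 3 = 1 ∨ x % 3 = 2 := by omega
  rcases h with h | h | h
  · left
    obtain ⟨y, rfl⟩ := Int.dvd_of_emod_eq_zero h
    refine ⟨h, ?_⟩
    rw [mul_pow]; omega
  all_goals
    (have h2 := Int.mul_emod x x 3; rw [h, ← pow_two] at h2; norm_num at h2; omega)

lemma ex4 (x : ℤ) (h : x % 2 = 1) : ∃ (a : ℤˣ) (w : ℤ), x = a * (4 * w + 1) := by
  rcases (show x % 4 = 1 ∨ x % 4 = 3 by omega) with h | h
  · exact ⟨1, x / 4, by simp; omega⟩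
  · exact ⟨-1, (-x) / 4, by simp; omega⟩

lemma ex3' (x : ℤ) (h : x % 3 ≠ 0) : ∃ (a : ℤˣ) (w : ℤ), x = a * (3 * w + 1) := by
  rcases (show x % 3 = 1 ∨ x % 3 = 2 by omega) with h | h
  · exact ⟨1, x / 3, by simp; omega⟩
  · exact ⟨-1, (-x) / 3, by simp; omega⟩

lemma ex6 (x : ℤ) (h : x % 3 ≠ 0) (h2 : x % 2 = 1) : ∃ (a : ℤˣ) (w : ℤ), x = a * (6 * w + 1) := by
  rcases (show x % 6 = 1 ∨ x % 6 = 5 by omega) with h | h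
  · exact ⟨1, x / 6, by simp; omega⟩
  · exact ⟨-1, (-x) / 6, by simp; omega⟩

lemma uinj (k : ℤ) (hk : k = 3 ∨ k = 4 ∨ k = 6) (a b : ℤˣ) (x y : ℤ)
    (h : (a : ℤ) * (k * x + 1) = b * (k * y + 1)) : a = b ∧ x = y := by
  rcases hk with rfl | rfl | rfl <;>
  rcases Int.units_eq_one_or a with rfl | rfl <;> rcases Int.units_eq_one_or b with rfl | rfl <;>
    simp only [Units.val_one, Units.val_neg] at h <;>
    first
    | exact ⟨rfl, by omega⟩
    | (exfalso; omega)

lemma usq (a : ℤˣ) : (a : ℤ) ^ 2 = 1 := by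
  rcases Int.units_eq_one_or a with rfl | rfl <;> simp

def TT (N : ℤ) : Set (ℤ × ℤ × ℤ) := {p | p.1 ^ 2 + 2 * p.2.1 ^ 2 + 6 * p.2.2 ^ 2 = N}
def SS (N : ℤ) : Set (ℤ × ℤ × ℤ) := {p | 3 * p.1 ^ 2 + 2 * p.2.1 ^ 2 + 2 * p.2.2 ^ 2 = N}

lemma exA (w y z : ℤ) (m : ℕ) : ex3 3 1 5 1 3 3 (w, y, z) = m ↔
    3 * (4 * w + 1) ^ 2 + 8 * (3 * y + 1) ^ 2 + 72 * z ^ 2 = 24 * m + 11 := by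
  have h1 := (ex_two 3 1 (by norm_num) (by norm_num) w).1
  have h2 := (ex_two 5 1 (by norm_num) (by norm_num) y).1
  have h3 := (ex_two 3 3 (by norm_num) (by norm_num) z).1
  unfold ex3; zify; push_cast at *
  constructor <;> intro h <;> nlinarith

lemma exB (w y z : ℤ) (m : ℕ) : ex3 9 3 4 2 1 1 (w, y, z) = m ↔
    9 * (4 * w + 1) ^ 2 + 2 * (6 * y + 1) ^ 2 + 24 * z ^ 2 = 24 * m + 11 := by
  have h1 := (ex_two 9 3 (by norm_num) (by norm_num) w).1
  have h2 := (ex_two 4 2 (by norm_num) (by norm_num) y).1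
  have h3 := (ex_two 1 1 (by norm_num) (by norm_num) z).1
  unfold ex3; zify; push_cast at *
  constructor <;> intro h <;> nlinarith

lemma exC (w y z : ℤ) (m : ℕ) : ex3 3 1 5 1 5 1 (w, y, z) = m ↔
    3 * (4 * w + 1) ^ 2 + 8 * (3 * y + 1) ^ 2 + 8 * (3 * z + 1) ^ 2 = 24 * m + 19 := by
  have h1 := (ex_two 3 1 (by norm_num) (by norm_num) w).1
  have h2 := (ex_two 5 1 (by norm_num) (by norm_num) y).1
  have h3 := (ex_two 5 1 (by norm_num) (by norm_num) z).1
  unfold ex3; zify; push_cast at *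
  constructor <;> intro h <;> nlinarith

lemma exD (w y z : ℤ) (m : ℕ) : ex3 2 1 18 6 1 1 (w, y, z) = m ↔
    (6 * w + 1) ^ 2 + 18 * (4 * y + 1) ^ 2 + 24 * z ^ 2 = 24 * m + 19 := by
  have h1 := (ex_two 2 1 (by norm_num) (by norm_num) w).1
  have h2 := (ex_two 18 6 (by norm_num) (by norm_num) y).1
  have h3 := (ex_two 1 1 (by norm_num) (by norm_num) z).1
  unfold ex3; zify; push_cast at *
  constructor <;> intro h <;> nlinarith

lemma cardU : Nat.card ℤˣ = 2 := by simp

lemma cardB : Nat.card Bool = 2 := by simp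

lemma cardTB (m : ℕ) : Nat.card (TT (24 * m + 11)) = 4 * Nat.card {v // ex3 9 3 4 2 1 1 v = m} := by
  let f : ℤˣ × ℤˣ × {v // ex3 9 3 4 2 1 1 v = m} → TT (24 * m + 11) := fun p =>
    ⟨(3 * (p.1 * (4 * p.2.2.1.1 + 1)), p.2.1 * (6 * p.2.2.1.2.1 + 1), 2 * p.2.2.1.2.2), by
      obtain ⟨a, b, ⟨⟨w, y, z⟩, h⟩⟩ := p
      rw [exB] at h
      simp only [TT, Set.mem_ofPred_eq]
      have := usq a
      have := usq b
      simp only [mul_pow, usq]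
      linarith⟩
  have hf : Function.Bijective f := by
    constructor
    · rintro ⟨a, b, ⟨⟨w, y, z⟩, h⟩⟩ ⟨a', b', ⟨⟨w', y', z'⟩, h'⟩⟩ e
      simp only [f, Subtype.mk.injEq, Prod.mk.injEq] at e
      obtain ⟨e1, e2, e3⟩ := e
      obtain ⟨rfl, rfl⟩ := uinj 4 (by norm_num) a a' w w' (by linarith)
      obtain ⟨rfl, rfl⟩ := uinj 6 (by norm_num) b b' y y' e2
      obtain rfl : z = z' := by linarith
      rfl
    · rintro ⟨⟨x, y, z⟩, h⟩
      have h0 := h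
      simp only [TT, Set.mem_ofPred_eq] at h0
      have hx := sqmod8 x
      have hy := sqmod8 y
      have hz := sqmod8 z
      have hx3 := sqmod3 x
      have hy3 := sqmod3 y
      obtain ⟨X, rfl⟩ : ∃ X, x = 3 * X := ⟨x / 3, by omega⟩
      obtain ⟨a, w, rfl⟩ := ex4 X (by omega)
      obtain ⟨b, v, rfl⟩ := ex6 y (by omega) (by omega)
      obtain ⟨Z, rfl⟩ : ∃ Z, z = 2 * Z := ⟨z / 2, by omega⟩
      refine ⟨(a, b, ⟨(w, v, Z), ?_⟩), rfl⟩
      rw [exB]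
      simp only [mul_pow, usq] at h0
      linarith
  rw [← Nat.card_congr (Equiv.ofBijective f hf), Nat.card_prod, Nat.card_prod, cardU]; ring

lemma cardTD (m : ℕ) : Nat.card (TT (24 * m + 19)) = 4 * Nat.card {v // ex3 2 1 18 6 1 1 v = m} := by
  let f : ℤˣ × ℤˣ × {v // ex3 2 1 18 6 1 1 v = m} → TT (24 * m + 19) := fun p =>
    ⟨(p.1 * (6 * p.2.2.1.1 + 1), 3 * (p.2.1 * (4 * p.2.2.1.2.1 + 1)), 2 * p.2.2.1.2.2), by
      obtain ⟨a, b, ⟨⟨w, y, z⟩, h⟩⟩ := p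
      rw [exD] at h
      simp only [TT, Set.mem_ofPred_eq]
      simp only [mul_pow, usq]
      linarith⟩
  have hf : Function.Bijective f := by
    constructor
    · rintro ⟨a, b, ⟨⟨w, y, z⟩, h⟩⟩ ⟨a', b', ⟨⟨w', y', z'⟩, h'⟩⟩ e
      simp only [f, Subtype.mk.injEq, Prod.mk.injEq] at e
      obtain ⟨e1, e2, e3⟩ := e
      obtain ⟨rfl, rfl⟩ := uinj 6 (by norm_num) a a' w w' e1
      obtain ⟨rfl, rfl⟩ := uinj 4 (by norm_num) b b' y y' (by linarith)
      obtain rfl : z = z' := by linarith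
      rfl
    · rintro ⟨⟨x, y, z⟩, h⟩
      have h0 := h
      simp only [TT, Set.mem_ofPred_eq] at h0
      have hx := sqmod8 x
      have hy := sqmod8 y
      have hz := sqmod8 z
      have hx3 := sqmod3 x
      have hy3 := sqmod3 y
      obtain ⟨Y, rfl⟩ : ∃ Y, y = 3 * Y := ⟨y / 3, by omega⟩
      obtain ⟨a, w, rfl⟩ := ex6 x (by omega) (by omega)
      obtain ⟨b, v, rfl⟩ := ex4 Y (by omega)
      obtain ⟨Z, rfl⟩ : ∃ Z, z = 2 * Z := ⟨z / 2, by omega⟩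
      refine ⟨(a, b, ⟨(w, v, Z), ?_⟩), rfl⟩
      rw [exD]
      simp only [mul_pow, usq] at h0
      linarith
  rw [← Nat.card_congr (Equiv.ofBijective f hf), Nat.card_prod, Nat.card_prod, cardU]; ring

lemma cardSC (m : ℕ) : Nat.card (SS (24 * m + 19)) = 8 * Nat.card {v // ex3 3 1 5 1 5 1 v = m} := by
  let f : ℤˣ × ℤˣ × ℤˣ × {v // ex3 3 1 5 1 5 1 v = m} → SS (24 * m + 19) := fun p =>
    ⟨(p.1 * (4 * p.2.2.2.1.1 + 1), 2 * (p.2.1 * (3 * p.2.2.2.1.2.1 + 1)),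
      2 * (p.2.2.1 * (3 * p.2.2.2.1.2.2 + 1))), by
      obtain ⟨a, b, c, ⟨⟨w, y, z⟩, h⟩⟩ := p
      rw [exC] at h
      simp only [SS, Set.mem_ofPred_eq]
      simp only [mul_pow, usq]
      linarith⟩
  have hf : Function.Bijective f := by
    constructor
    · rintro ⟨a, b, c, ⟨⟨w, y, z⟩, h⟩⟩ ⟨a', b', c', ⟨⟨w', y', z'⟩, h'⟩⟩ e
      simp only [f, Subtype.mk.injEq, Prod.mk.injEq] at e
      obtain ⟨e1, e2, e3⟩ := e
      obtain ⟨rfl, rfl⟩ := uinj 4 (by norm_num) a a' w w' e1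
      obtain ⟨rfl, rfl⟩ := uinj 3 (by norm_num) b b' y y' (by linarith)
      obtain ⟨rfl, rfl⟩ := uinj 3 (by norm_num) c c' z z' (by linarith)
      rfl
    · rintro ⟨⟨x, y, z⟩, h⟩
      have h0 := h
      simp only [SS, Set.mem_ofPred_eq] at h0
      have hx := sqmod8 x
      have hy := sqmod8 y
      have hz := sqmod8 z
      have hy3 := sqmod3 y
      have hz3 := sqmod3 z
      obtain ⟨Y, rfl⟩ : ∃ Y, y = 2 * Y := ⟨y / 2, by omega⟩
      obtain ⟨Z, rfl⟩ : ∃ Z, z = 2 * Z := ⟨z / 2, by omega⟩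
      obtain ⟨a, w, rfl⟩ := ex4 x (by omega)
      obtain ⟨b, v, rfl⟩ := ex3' Y (by omega)
      obtain ⟨c, u, rfl⟩ := ex3' Z (by omega)
      refine ⟨(a, b, c, ⟨(w, v, u), ?_⟩), rfl⟩
      rw [exC]
      simp only [mul_pow, usq] at h0
      linarith
  rw [← Nat.card_congr (Equiv.ofBijective f hf)]
  simp only [Nat.card_prod, cardU]; ring

lemma cardSA (m : ℕ) : Nat.card (SS (24 * m + 11)) = 8 * Nat.card {v // ex3 3 1 5 1 3 3 v = m} := by
  let f : Bool × ℤˣ × ℤˣ × {v // ex3 3 1 5 1 3 3 v = m} → SS (24 * m + 11) := fun p =>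
    ⟨(p.2.1 * (4 * p.2.2.2.1.1 + 1),
      if p.1 then 2 * (p.2.2.1 * (3 * p.2.2.2.1.2.1 + 1)) else 6 * p.2.2.2.1.2.2,
      if p.1 then 6 * p.2.2.2.1.2.2 else 2 * (p.2.2.1 * (3 * p.2.2.2.1.2.1 + 1))), by
      obtain ⟨t, a, b, ⟨⟨w, y, z⟩, h⟩⟩ := p
      rw [exA] at h
      simp only [SS, Set.mem_ofPred_eq]
      cases t <;> simp [mul_pow, usq] <;> linarith⟩
  have nd : ∀ (b : ℤˣ) (y z : ℤ), 2 * (b * (3 * y + 1)) ≠ 6 * z := by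
    intro b y z
    rcases Int.units_eq_one_or b with rfl | rfl <;> simp <;> omega
  have hf : Function.Bijective f := by
    constructor
    · rintro ⟨t, a, b, ⟨⟨w, y, z⟩, h⟩⟩ ⟨t', a', b', ⟨⟨w', y', z'⟩, h'⟩⟩ e
      simp only [f, Subtype.mk.injEq, Prod.mk.injEq] at e
      obtain ⟨e1, e2, e3⟩ := e
      obtain ⟨rfl, rfl⟩ := uinj 4 (by norm_num) a a' w w' e1
      cases t <;> cases t' <;> simp only [if_true, if_false, Bool.false_eq_true] at e2 e3
      · obtain ⟨rfl, rfl⟩ := uinj 3 (by norm_num) b b' y y' (by linarith)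
        obtain rfl : z = z' := by linarith
        rfl
      · exact absurd e3 (nd _ _ _)
      · exact absurd e2 (nd _ _ _)
      · obtain ⟨rfl, rfl⟩ := uinj 3 (by norm_num) b b' y y' (by linarith)
        obtain rfl : z = z' := by linarith
        rfl
    · rintro ⟨⟨x, y, z⟩, h⟩
      have h0 := h
      simp only [SS, Set.mem_ofPred_eq] at h0
      have hx := sqmod8 x
      have hy := sqmod8 y
      have hz := sqmod8 z
      have hy3 := sqmod3 y
      have hz3 := sqmod3 z
      obtain ⟨a, w, rfl⟩ := ex4 x (by omega)
      rcases hy3 with hy3 | hy3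
      · obtain ⟨Y, rfl⟩ : ∃ Y, y = 6 * Y := ⟨y / 6, by omega⟩
        obtain ⟨Z, rfl⟩ : ∃ Z, z = 2 * Z := ⟨z / 2, by omega⟩
        obtain ⟨b, v, rfl⟩ := ex3' Z (by omega)
        refine ⟨(false, a, b, ⟨(w, v, Y), ?_⟩), rfl⟩
        rw [exA]
        simp only [mul_pow, usq] at h0
        linarith
      · obtain ⟨Z, rfl⟩ : ∃ Z, z = 6 * Z := ⟨z / 6, by omega⟩
        obtain ⟨Y, rfl⟩ : ∃ Z, y = 2 * Z := ⟨y / 2, by omega⟩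
        obtain ⟨b, v, rfl⟩ := ex3' Y (by omega)
        refine ⟨(true, a, b, ⟨(w, v, Z), ?_⟩), rfl⟩
        rw [exA]
        simp only [mul_pow, usq] at h0
        linarith
  rw [← Nat.card_congr (Equiv.ofBijective f hf)]
  simp only [Nat.card_prod, cardU, cardB]; ring

lemma SS_eq (N : ℤ) (hN : 0 < N) (h8 : N % 8 = 3) (h3 : N % 3 ≠ 0) :
    Nat.card (SS N) = 2 * Nat.card (TT N) := by
  rcases (show N % 24 = 11 ∨ N % 24 = 19 by omega) with h | h
  · obtain ⟨m, rfl⟩ : ∃ m : ℕ, N = 24 * m + 11 := ⟨(N / 24).toNat, by omega⟩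
    rw [cardSA, cardTB, count1]; ring
  · obtain ⟨m, rfl⟩ : ∃ m : ℕ, N = 24 * m + 19 := ⟨(N / 24).toNat, by omega⟩
    rw [cardSC, cardTD, count2]; ring

/-- diagonal forms -/
def QQ (a b c M : ℤ) : Set (ℤ × ℤ × ℤ) := {p | a * p.1 ^ 2 + b * p.2.1 ^ 2 + c * p.2.2 ^ 2 = M}

lemma rep_eq (a b c M : ℤ) : rep a b c 0 0 0 M = Nat.card (QQ a b c M) := by
  rw [Nat.card_coe_set_eq]
  unfold rep QQ
  congr 1
  ext p
  simp only [Set.mem_ofPred_eq]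
  constructor <;> intro h <;> linarith

lemma card166 (N : ℤ) : Nat.card (QQ 1 6 6 (3 * N)) = Nat.card (SS N) := by
  let f : SS N → QQ 1 6 6 (3 * N) := fun p => ⟨(3 * p.1.1, p.1.2.1, p.1.2.2), by
    obtain ⟨⟨x, y, z⟩, h⟩ := p
    have h0 := h
    simp only [SS, QQ, Set.mem_ofPred_eq] at h0 ⊢
    linarith⟩
  have hf : Function.Bijective f := by
    constructor
    · rintro ⟨⟨x, y, z⟩, h⟩ ⟨⟨x', y', z'⟩, h'⟩ e
      simp only [f, Subtype.mk.injEq, Prod.mk.injEq] at e ⊢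
      omega
    · rintro ⟨⟨x, y, z⟩, h⟩
      have h0 := h
      simp only [QQ, Set.mem_ofPred_eq] at h0
      have := sqmod3 x
      obtain ⟨X, rfl⟩ : ∃ X, x = 3 * X := ⟨x / 3, by omega⟩
      exact ⟨⟨(X, y, z), by simp only [SS, Set.mem_ofPred_eq]; linarith⟩, rfl⟩
  exact (Nat.card_congr (Equiv.ofBijective f hf)).symm

lemma card236 (N : ℤ) : Nat.card (QQ 2 3 6 (3 * N)) = Nat.card (TT N) := by
  let f : TT N → QQ 2 3 6 (3 * N) := fun p => ⟨(3 * p.1.2.2, p.1.1, p.1.2.1), by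
    obtain ⟨⟨x, y, z⟩, h⟩ := p
    have h0 := h
    simp only [TT, QQ, Set.mem_ofPred_eq] at h0 ⊢
    linarith⟩
  have hf : Function.Bijective f := by
    constructor
    · rintro ⟨⟨x, y, z⟩, h⟩ ⟨⟨x', y', z'⟩, h'⟩ e
      simp only [f, Subtype.mk.injEq, Prod.mk.injEq] at e ⊢
      omega
    · rintro ⟨⟨x, y, z⟩, h⟩
      have h0 := h
      simp only [QQ, Set.mem_ofPred_eq] at h0
      have := sqmod3 x
      obtain ⟨X, rfl⟩ : ∃ X, x = 3 * X := ⟨x / 3, by omega⟩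
      exact ⟨⟨(y, z, X), by simp only [TT, Set.mem_ofPred_eq]; linarith⟩, rfl⟩
  exact (Nat.card_congr (Equiv.ofBijective f hf)).symm

lemma TT_facts (N : ℤ) (h8 : N % 8 = 3) (h3 : N % 3 ≠ 0) (s t u : ℤ) (h : (s, t, u) ∈ TT N) :
    s % 2 = 1 ∧ t % 2 = 1 ∧ u % 2 = 0 ∧ (s + t) % 3 ≠ 0 := by
  simp only [TT, Set.mem_ofPred_eq] at h
  have := sqmod8 s
  have := sqmod8 t
  have := sqmod8 u
  have := sqmod3 s
  have := sqmod3 t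
  refine ⟨by omega, by omega, by omega, by omega⟩

lemma card188 (N : ℤ) (h8 : N % 8 = 3) (h3 : N % 3 ≠ 0) :
    Nat.card (QQ 1 8 8 (3 * N)) = 4 * Nat.card (TT N) := by
  let f : Bool × ℤˣ × TT N → QQ 1 8 8 (3 * N) := fun p =>
    ⟨(p.2.2.1.1 - 2 * p.2.2.1.2.1,
      if p.1 then p.2.1 * ((p.2.2.1.1 + p.2.2.1.2.1) / 2) else 3 * (p.2.2.1.2.2 / 2),
      if p.1 then 3 * (p.2.2.1.2.2 / 2) else p.2.1 * ((p.2.2.1.1 + p.2.2.1.2.1) / 2)), by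
    obtain ⟨c, b, ⟨⟨s, t, u⟩, h⟩⟩ := p
    obtain ⟨f1, f2, f3, f4⟩ := TT_facts N h8 h3 s t u h
    have h0 := h
    simp only [TT, QQ, Set.mem_ofPred_eq] at h0 ⊢
    obtain ⟨u, rfl⟩ : ∃ U, u = 2 * U := ⟨u / 2, by omega⟩
    obtain ⟨v, rfl⟩ : ∃ v, s = 2 * v - t := ⟨(s + t) / 2, by omega⟩
    rw [show (2 * v - t + t) / 2 = v by omega, show 2 * u / 2 = u by omega]
    cases c <;> simp only [if_true, if_false, Bool.false_eq_true, mul_pow, usq] <;> linarith⟩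
  have hf : Function.Bijective f := by
    constructor
    · rintro ⟨c, b, ⟨⟨s, t, u⟩, h⟩⟩ ⟨c', b', ⟨⟨s', t', u'⟩, h'⟩⟩ e
      obtain ⟨f1, f2, f3, f4⟩ := TT_facts N h8 h3 s t u h
      obtain ⟨g1, g2, g3, g4⟩ := TT_facts N h8 h3 s' t' u' h'
      simp only [f, Subtype.mk.injEq, Prod.mk.injEq] at e ⊢
      obtain ⟨e1, e2, e3⟩ := e
      rcases Int.units_eq_one_or b with rfl | rfl <;> rcases Int.units_eq_one_or b' with rfl | rfl <;>
      cases c <;> cases c' <;> simp only [if_true, if_false, Bool.false_eq_true, Units.val_one, Units.val_neg] at e2 e3 <;>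
      first
      | (exfalso; omega)
      | (refine ⟨rfl, rfl, ?_, ?_, ?_⟩ <;> omega)
    · rintro ⟨⟨x, y, z⟩, h⟩
      have h0 := h
      simp only [QQ, Set.mem_ofPred_eq] at h0
      have key : ∀ y z : ℤ, x ^ 2 + 8 * y ^ 2 + 8 * z ^ 2 = 3 * N → z % 3 = 0 → ∃ (b : ℤˣ) (s t u : ℤ),
          (s, t, u) ∈ TT N ∧ x = s - 2 * t ∧ y = b * ((s + t) / 2) ∧ z = 3 * (u / 2) := by
        intro y z h hz
        obtain ⟨Z, rfl⟩ : ∃ Z, z = 3 * Z := ⟨z / 3, by omega⟩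
        have hx3 := sqmod3 x
        have hy3 := sqmod3 y
        have h1 : x % 3 ≠ 0 := by
          intro h1
          have : (3 * Z) ^ 2 = 9 * Z ^ 2 := by ring
          omega
        have h2 : y % 3 ≠ 0 := by
          have : (3 * Z) ^ 2 = 9 * Z ^ 2 := by ring
          omega
        rcases (show (2 * y - x) % 3 = 0 ∨ (-2 * y - x) % 3 = 0 by
            rcases (show x % 3 = 1 ∨ x % 3 = 2 by omega) with i | i <;>
            rcases (show y % 3 = 1 ∨ y % 3 = 2 by omega) with j | j <;> omega) with h4 | h4
        · obtain ⟨t, ht⟩ := Int.dvd_of_emod_eq_zero h4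
          obtain rfl : x = 2 * y - 3 * t := by omega
          refine ⟨1, 2 * y - t, t, 2 * Z, ?_, by ring, ?_, by omega⟩
          · simp only [TT, Set.mem_ofPred_eq]; linarith
          · simp
        · obtain ⟨t, ht⟩ := Int.dvd_of_emod_eq_zero h4
          obtain rfl : x = -2 * y - 3 * t := by omega
          refine ⟨-1, -2 * y - t, t, 2 * Z, ?_, by ring, ?_, by omega⟩
          · simp only [TT, Set.mem_ofPred_eq]; linarith
          · rw [show (-2 * y - t + t) / 2 = -y by omega]; simp
      have hx3 := sqmod3 x
      have hy3 := sqmod3 y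
      have hz3 := sqmod3 z
      rcases (show z % 3 = 0 ∨ y % 3 = 0 by omega) with hh | hh
      · obtain ⟨b, s, t, u, k1, k2, k3, k4⟩ := key y z (by linarith) hh
        exact ⟨(true, b, ⟨(s, t, u), k1⟩), by simp [f, k2, k3, k4]⟩
      · obtain ⟨b, s, t, u, k1, k2, k3, k4⟩ := key z y (by linarith) hh
        exact ⟨(false, b, ⟨(s, t, u), k1⟩), by simp [f, k2, k3, k4]⟩
  rw [← Nat.card_congr (Equiv.ofBijective f hf)]
  simp only [Nat.card_prod, cardU, cardB]; ring

theorem disc144_corollaries (M : ℤ) (hM : 0 < M) (h8 : M % 8 = 1) (h3 : 3 ∣ M)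
    (h9 : ¬ (3 ^ 2 : ℤ) ∣ M) :
    rep 1 6 6 0 0 0 M = 2 * rep 2 3 6 0 0 0 M ∧
    rep 1 8 8 0 0 0 M = 2 * rep 1 6 6 0 0 0 M := by
  obtain ⟨N, rfl⟩ := h3
  have hN8 : N % 8 = 3 := by omega
  have hN3 : N % 3 ≠ 0 := by
    intro h
    apply h9
    obtain ⟨k, rfl⟩ := Int.dvd_of_emod_eq_zero h
    exact ⟨k, by ring⟩
  have h := SS_eq N (by omega) hN8 hN3
  simp only [rep_eq, card166, card236, card188 N hN8 hN3, h]
  exact ⟨trivial, by ring⟩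
end

section
/- As formal power series in ℤ⟦q⟧: φ(q)·ψ(q²)² = ψ(q)·ψ(q³)·φ(q³) + q·φ(q)·ψ(q⁶)². -/
open PowerSeries

/-- `phi k` is the theta series `φ(q^k) = ∑_{m ∈ ℤ} q^(k·m²)`, i.e. the formal power
series whose coefficient of `qⁿ` is `#{m ∈ ℤ : n = k·m²}`. -/
noncomputable def phi (k : ℕ) : PowerSeries ℤ :=
  PowerSeries.mk fun n => ({m : ℤ | (n : ℤ) = k * m ^ 2}.ncard : ℤ)

/-- `psi k` is the theta series `ψ(q^k) = ∑_{m ≥ 0} q^(k·m(m+1)/2)`, i.e. the formal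
power series whose coefficient of `qⁿ` is `#{m ∈ ℤ, m ≥ 0 : n = k·m(m+1)/2}`. -/
noncomputable def psi (k : ℕ) : PowerSeries ℤ :=
  PowerSeries.mk fun n => ({m : ℤ | 0 ≤ m ∧ (n : ℤ) = k * (m * (m + 1) / 2)}.ncard : ℤ)

namespace ThetaAux

/-- nonnegative weight with finite sublevel sets -/
def Good {ι : Type} (w : ι → ℤ) : Prop := (∀ i, 0 ≤ w i) ∧ ∀ n : ℤ, {i | w i ≤ n}.Finite

/-- generating function of a weight -/
noncomputable def gen {ι : Type} (w : ι → ℤ) : PowerSeries ℤ :=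
  PowerSeries.mk fun n => ({i : ι | w i = (n : ℤ)}.ncard : ℤ)

lemma Good.fin {ι : Type} {w : ι → ℤ} (h : Good w) (n : ℤ) : {i | w i = n}.Finite :=
  (h.2 n).subset fun _ hi => le_of_eq hi

lemma Good.mono {ι : Type} {w w' : ι → ℤ} (h : Good w) (hle : ∀ i, w i ≤ w' i) : Good w' :=
  ⟨fun i => (h.1 i).trans (hle i), fun n => (h.2 n).subset fun i hi => (hle i).trans hi⟩

lemma Good.prod {ι κ : Type} {w : ι → ℤ} {v : κ → ℤ} (h : Good w) (h' : Good v) :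
    Good (fun p : ι × κ => w p.1 + v p.2) := by
  refine ⟨fun p => add_nonneg (h.1 _) (h'.1 _), fun n => ?_⟩
  refine ((h.2 n).prod (h'.2 n)).subset ?_
  rintro ⟨i, j⟩ hij
  have h1 := h.1 i
  have h2 := h'.1 j
  simp only [Set.mem_ofPred_eq, Set.mem_prod] at hij ⊢
  constructor <;> linarith

lemma gen_mul {ι κ : Type} {w : ι → ℤ} {v : κ → ℤ} (h : Good w) (h' : Good v) :
    gen w * gen v = gen (fun p : ι × κ => w p.1 + v p.2) := by
  classical
  ext n
  rw [PowerSeries.coeff_mul]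
  simp only [gen, PowerSeries.coeff_mk]
  have hf := (h.prod h').fin n
  rw [Set.ncard_eq_toFinset_card _ hf]
  rw [Finset.card_eq_sum_card_fiberwise (t := Finset.HasAntidiagonal.antidiagonal n)
    (f := fun p : ι × κ => ((w p.1).toNat, (v p.2).toNat))]
  · push_cast
    refine Finset.sum_congr rfl ?_
    rintro ⟨a, b⟩ hab
    rw [Finset.HasAntidiagonal.mem_antidiagonal] at hab
    simp only at hab
    rw [← Nat.cast_mul, ← Set.ncard_prod, ← Set.ncard_coe_finset]
    congr 2
    ext ⟨i, j⟩
    have h1 := h.1 i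
    have h2 := h'.1 j
    simp
    omega
  · rintro ⟨i, j⟩ hij
    have h1 := h.1 i
    have h2 := h'.1 j
    simp at hij ⊢
    omega

lemma gen_add {ι κ : Type} {w : ι → ℤ} {v : κ → ℤ} (h : Good w) (h' : Good v) :
    gen w + gen v = gen (Sum.elim w v) := by
  ext n
  simp only [gen, PowerSeries.coeff_mk, map_add]
  rw [← Nat.cast_add]
  congr 1
  rw [← Set.ncard_image_of_injective {i | w i = (n : ℤ)} (Sum.inl_injective (β := κ)),
    ← Set.ncard_image_of_injective {i | v i = (n : ℤ)} (Sum.inr_injective (α := ι)),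
    ← Set.ncard_union_eq ?_ ((h.fin n).image _) ((h'.fin n).image _)]
  · congr 1
    ext (i | j) <;> simp
  · rw [Set.disjoint_left]
    rintro x ⟨a, _, rfl⟩ ⟨b, _, hb⟩
    cases hb

lemma gen_bij {ι κ : Type} {w : ι → ℤ} {v : κ → ℤ} (e : κ → ι) (hi : Function.Injective e)
    (hs : Function.Surjective e) (hw : ∀ k, w (e k) = v k) : gen v = gen w := by
  ext n
  simp only [gen, PowerSeries.coeff_mk]
  rw [← Set.ncard_image_of_injective _ hi]
  congr 2
  ext i
  simp only [Set.mem_image, Set.mem_ofPred_eq]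
  constructor
  · rintro ⟨k, hk, rfl⟩
    rw [hw, hk]
  · intro h
    obtain ⟨k, rfl⟩ := hs i
    exact ⟨k, by rw [← hw, h], rfl⟩

lemma gen_shift {ι : Type} {w : ι → ℤ} (h : Good w) :
    X ^ 2 * gen w = gen (fun i => w i + 2) := by
  ext n
  rw [PowerSeries.coeff_X_pow_mul']
  simp only [gen, PowerSeries.coeff_mk]
  split_ifs with hn
  · congr 2
    ext i
    simp only [Set.mem_ofPred_eq]
    omega
  · symm
    rw [Nat.cast_eq_zero]
    convert Set.ncard_empty ι
    ext i
    have := h.1 i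
    simp only [Set.mem_ofPred_eq, Set.mem_empty_iff_false, iff_false]
    omega

lemma gen_pos {ι : Type} {w : ι → ℤ} (h : Good w) (i : ι) (hi : w i = 0) :
    0 < constantCoeff (gen w) := by
  rw [← PowerSeries.coeff_zero_eq_constantCoeff_apply]
  simp only [gen, PowerSeries.coeff_mk]
  have := (Set.ncard_pos (h.fin ((0 : ℕ) : ℤ))).2 ⟨i, by simpa using hi⟩
  exact_mod_cast this

/-- the substitution `q ↦ q²` -/
noncomputable abbrev E : PowerSeries ℤ →ₐ[ℤ] PowerSeries ℤ := PowerSeries.expand 2 two_ne_zero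

lemma coeff_E (f : PowerSeries ℤ) (n : ℕ) :
    coeff n (E f) = if 2 ∣ n then coeff (n / 2) f else 0 := PowerSeries.coeff_expand _ _ _

lemma E_inj : Function.Injective E := by
  intro f g h
  ext n
  have := congrArg (coeff (2 * n)) h
  simpa [coeff_E] using this

lemma E_count {ι : Type} (P : ℕ → ι → Prop) (Q : ℕ → ι → Prop)
    (h : ∀ n i, Q (2 * n) i ↔ P n i) (h' : ∀ n i, Q n i → 2 ∣ n) :
    E (PowerSeries.mk fun n => ({i | P n i}.ncard : ℤ)) =
      PowerSeries.mk fun n => ({i | Q n i}.ncard : ℤ) := by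
  ext n
  rw [coeff_E]
  simp only [PowerSeries.coeff_mk]
  split_ifs with hn
  · obtain ⟨m, rfl⟩ := hn
    simp [h]
  · symm
    rw [Nat.cast_eq_zero]
    convert Set.ncard_empty ι
    ext i
    simp only [Set.mem_ofPred_eq, Set.mem_empty_iff_false, iff_false]
    exact fun hi => hn (h' _ _ hi)


lemma E_gen {ι : Type} (w : ι → ℤ) : E (gen w) = gen (fun i => 2 * w i) := by
  unfold gen
  refine E_count (fun n i => w i = (n : ℤ)) (fun n i => 2 * w i = (n : ℤ)) ?_ ?_
  · intro n i
    push_cast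
    omega
  · intro n i h
    omega

lemma E_phi (k : ℕ) : E (phi k) = phi (2 * k) := by
  unfold phi
  apply E_count
  · intro n i
    push_cast
    rw [mul_assoc]
    omega
  · intro n i h
    push_cast at h
    rw [mul_assoc] at h
    omega

lemma E_psi (k : ℕ) : E (psi k) = psi (2 * k) := by
  unfold psi
  apply E_count
  · intro n i
    push_cast
    rw [mul_assoc]
    omega
  · intro n i h
    push_cast at h
    rw [mul_assoc] at h
    omega

/-- quadratic weight -/
def wT (A B m : ℤ) : ℤ := A * m ^ 2 + B * m

/-- hexagonal weight -/
def wC (p : ℤ × ℤ) : ℤ := 6 * p.1 ^ 2 + 6 * p.1 * p.2 + 6 * p.2 ^ 2 - 2 * p.1 + 2 * p.2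

lemma good_T (A B : ℤ) (hA : 0 < A) (h1 : B ≤ A) (h2 : -A ≤ B) : Good (wT A B) := by
  have key : ∀ m : ℤ, m ≤ wT A B m + 1 ∧ -m ≤ wT A B m + 1 ∧ 0 ≤ wT A B m := by
    intro m
    unfold wT
    rcases lt_trichotomy m 0 with h | h | h
    · have a1 : 0 ≤ (A - B) * (-m) := mul_nonneg (by linarith) (by linarith)
      have a2 : 0 ≤ (A - 1) * ((-m) * (-m - 1)) :=
        mul_nonneg (by linarith) (mul_nonneg (by linarith) (by linarith))
      refine ⟨?_, ?_, ?_⟩ <;> nlinarith [sq_nonneg (m + 1)]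
    · subst h
      simp
    · have a1 : 0 ≤ (A + B) * m := mul_nonneg (by linarith) (by linarith)
      have a2 : 0 ≤ (A - 1) * (m * (m - 1)) :=
        mul_nonneg (by linarith) (mul_nonneg (by linarith) (by linarith))
      refine ⟨?_, ?_, ?_⟩ <;> nlinarith [sq_nonneg (m - 1)]
  refine ⟨fun m => (key m).2.2, fun n => ?_⟩
  refine (Set.finite_Icc (-(n + 1)) (n + 1)).subset ?_
  intro m hm
  obtain ⟨k1, k2, k3⟩ := key m
  simp only [Set.mem_ofPred_eq, Set.mem_Icc] at hm ⊢
  constructor <;> linarith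

lemma good_C : Good wC := by
  refine ((good_T 3 (-2) (by norm_num) (by norm_num) (by norm_num)).prod
    (good_T 3 2 (by norm_num) (by norm_num) (by norm_num))).mono ?_
  rintro ⟨i, k⟩
  simp only [wT, wC]
  nlinarith [sq_nonneg (i + k)]

/-- one-dimensional theta series -/
noncomputable def T (A B : ℤ) : PowerSeries ℤ := gen (wT A B)

/-- the cubic theta series -/
noncomputable def CC : PowerSeries ℤ := gen wC

lemma T_neg (A B : ℤ) : T A (-B) = T A B := by
  refine gen_bij (fun m => -m) neg_injective neg_surjective ?_
  intro m
  simp only [wT]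
  ring

lemma E_T (A B : ℤ) : E (T A B) = T (2 * A) (2 * B) := by
  unfold T
  rw [E_gen]
  congr 1
  ext m
  simp only [wT]
  ring

lemma phi_eq (k : ℕ) : phi k = T k 0 := by
  unfold phi T gen
  congr 1
  ext n
  congr 2
  ext m
  simp only [wT, Set.mem_ofPred_eq]
  constructor <;> intro h <;> linarith

lemma psi_eq (k : ℕ) (hk : 0 < k) : 2 * psi (2 * k) = T k k := by
  have hg := good_T k k (by exact_mod_cast hk) le_rfl (by linarith)
  have hg' : Good (fun m : ℕ => wT k k m) := by
    refine ⟨fun m => hg.1 m, fun n => ?_⟩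
    exact Set.Finite.preimage (f := fun m : ℕ => (m : ℤ)) (Nat.cast_injective.injOn) (hg.2 n)
  have h1 : psi (2 * k) = gen (fun m : ℕ => wT k k m) := by
    unfold psi gen
    congr 1
    ext n
    congr 1
    rw [← Set.ncard_image_of_injective _ (Nat.cast_injective (R := ℤ))]
    congr 1
    ext m
    have hm : 2 * (m * (m + 1) / 2) = m * (m + 1) :=
      Int.mul_ediv_cancel' (Int.even_mul_succ_self m).two_dvd
    have hm' : ((2 * k : ℕ) : ℤ) * (m * (m + 1) / 2) = wT k k m := by
      push_cast
      unfold wT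
      linear_combination (k : ℤ) * hm
    simp only [Set.mem_ofPred_eq, Set.mem_image, hm']
    constructor
    · rintro ⟨h0, h⟩
      refine ⟨m.toNat, ?_, ?_⟩
      · rw [Int.toNat_of_nonneg h0, h]
      · exact Int.toNat_of_nonneg h0
    · rintro ⟨j, hj, rfl⟩
      exact ⟨by positivity, hj.symm⟩
  rw [two_mul, h1, gen_add hg' hg']
  refine gen_bij (Sum.elim (fun m : ℕ => (m : ℤ)) (fun m : ℕ => -1 - (m : ℤ))) ?_ ?_ ?_
  · rintro (a | a) (b | b) h <;> simp at h ⊢ <;> omega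
  · intro m
    by_cases h : 0 ≤ m
    · exact ⟨Sum.inl m.toNat, by simp; omega⟩
    · exact ⟨Sum.inr (-1 - m).toNat, by simp; omega⟩
  · rintro (a | a) <;> simp only [wT, Sum.elim_inl, Sum.elim_inr]
    ring

lemma f1 (k : ℤ) (hk : 0 < k) :
    T k k * T k k = 2 * (T (2 * k) 0 * T (2 * k) (2 * k)) := by
  have g1 := good_T k k (by linarith) (by linarith) (by linarith)
  have g2 := good_T (2 * k) 0 (by linarith) (by linarith) (by linarith)
  have g3 := good_T (2 * k) (2 * k) (by linarith) (by linarith) (by linarith)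
  unfold T
  rw [two_mul, gen_mul g1 g1, gen_mul g2 g3, gen_add (g2.prod g3) (g2.prod g3)]
  symm
  refine gen_bij (Sum.elim (fun p => (p.2 + p.1, p.2 - p.1))
    (fun p => (p.2 + p.1, -1 - p.2 + p.1))) ?_ ?_ ?_
  · rintro (⟨a, a'⟩ | ⟨a, a'⟩) (⟨b, b'⟩ | ⟨b, b'⟩) h <;> simp at h ⊢ <;> omega
  · rintro ⟨m, n⟩
    by_cases h : (m + n) % 2 = 0
    · exact ⟨Sum.inl ((m - n) / 2, (m + n) / 2), by simp; omega⟩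
    · exact ⟨Sum.inr ((m + n + 1) / 2, (m - n - 1) / 2), by simp; omega⟩
  · rintro (⟨a, a'⟩ | ⟨a, a'⟩) <;> simp only [wT, Sum.elim_inl, Sum.elim_inr] <;> ring

lemma f3 : T 3 1 * T 3 3 = 2 * (T 6 4 * T 6 2) := by
  have g1 := good_T 3 1 (by norm_num) (by norm_num) (by norm_num)
  have g1' := good_T 3 3 (by norm_num) (by norm_num) (by norm_num)
  have g3 := good_T 6 4 (by norm_num) (by norm_num) (by norm_num)
  have g2 := good_T 6 2 (by norm_num) (by norm_num) (by norm_num)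
  unfold T
  rw [two_mul, gen_mul g1 g1', gen_mul g3 g2, gen_add (g3.prod g2) (g3.prod g2)]
  symm
  refine gen_bij (Sum.elim (fun p => (p.1 - p.2, p.1 + p.2))
    (fun p => (p.1 - p.2, -1 - p.1 - p.2))) ?_ ?_ ?_
  · rintro (⟨a, a'⟩ | ⟨a, a'⟩) (⟨b, b'⟩ | ⟨b, b'⟩) h <;> simp at h ⊢ <;> omega
  · rintro ⟨m, n⟩
    by_cases h : (m + n) % 2 = 0
    · exact ⟨Sum.inl ((m + n) / 2, (n - m) / 2), by simp; omega⟩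
    · exact ⟨Sum.inr ((m - n - 1) / 2, (- m - n - 1) / 2), by simp; omega⟩
  · rintro (⟨a, a'⟩ | ⟨a, a'⟩) <;> simp only [wT, Sum.elim_inl, Sum.elim_inr] <;> ring

lemma f6 : T 3 1 * T 3 1 = T 6 2 * T 6 0 + X ^ 2 * (T 6 6 * T 6 4) := by
  have g1 := good_T 3 1 (by norm_num) (by norm_num) (by norm_num)
  have g2 := good_T 6 2 (by norm_num) (by norm_num) (by norm_num)
  have g3 := good_T 6 0 (by norm_num) (by norm_num) (by norm_num)
  have g4 := good_T 6 6 (by norm_num) (by norm_num) (by norm_num)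
  have g5 := good_T 6 4 (by norm_num) (by norm_num) (by norm_num)
  unfold T
  rw [gen_mul g1 g1, gen_mul g2 g3, gen_mul g4 g5, gen_shift (g4.prod g5),
    gen_add (g2.prod g3) ((g4.prod g5).mono (fun i => by linarith))]
  symm
  refine gen_bij (Sum.elim (fun p => (p.1 + p.2, p.1 - p.2))
    (fun p => (p.1 - p.2, -1 - p.2 - p.1))) ?_ ?_ ?_
  · rintro (⟨a, a'⟩ | ⟨a, a'⟩) (⟨b, b'⟩ | ⟨b, b'⟩) h <;> simp at h ⊢ <;> omega
  · rintro ⟨m, n⟩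
    by_cases h : (m + n) % 2 = 0
    · exact ⟨Sum.inl ((m + n) / 2, (m - n) / 2), by simp; omega⟩
    · exact ⟨Sum.inr ((m - n - 1) / 2, (- m - n - 1) / 2), by simp; omega⟩
  · rintro (⟨a, a'⟩ | ⟨a, a'⟩) <;> simp only [wT, Sum.elim_inl, Sum.elim_inr] <;> ring

/-- the cubic bijection -/
def e3 (p : ℤ × (ℤ × ℤ)) : (ℤ × ℤ) × ℤ :=
  if p.1 % 3 = 0 then ((p.2.1 + p.1 / 3, -p.2.1 - p.2.2 + p.1 / 3), p.2.2 + p.1 / 3)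
  else if p.1 % 3 = 1 then
    ((p.2.2 + p.1 / 3 + 1, p.2.1 + p.1 / 3), -p.2.1 - p.2.2 + p.1 / 3)
  else ((-p.2.1 - p.2.2 + p.1 / 3 + 1, p.2.2 + p.1 / 3 + 1), p.2.1 + p.1 / 3)

lemma f4 (μ : ℤ) (h0 : 0 ≤ μ) (h1 : μ ≤ 1) :
    T 1 (μ - 1) * CC = T 3 (μ - 3) * T 3 (μ - 1) * T 3 (μ + 1) := by
  have g1 := good_T 1 (μ - 1) (by linarith) (by linarith) (by linarith)
  have g2 := good_T 3 (μ - 3) (by linarith) (by linarith) (by linarith)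
  have g3 := good_T 3 (μ - 1) (by linarith) (by linarith) (by linarith)
  have g4 := good_T 3 (μ + 1) (by linarith) (by linarith) (by linarith)
  unfold T CC
  rw [gen_mul g1 good_C, gen_mul g2 g3, gen_mul (g2.prod g3) g4]
  refine gen_bij e3 ?_ ?_ ?_
  · rintro ⟨a, i, k⟩ ⟨b, i', k'⟩ h
    simp only [e3] at h
    split_ifs at h <;> simp only [Prod.mk.injEq] at h ⊢ <;> omega
  · rintro ⟨⟨a, b⟩, c⟩
    rcases (by omega : (a + b + c) % 3 = 0 ∨ (a + b + c) % 3 = 1 ∨ (a + b + c) % 3 = 2)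
      with h | h | h
    · refine ⟨(a + b + c, (a - (a + b + c) / 3, c - (a + b + c) / 3)), ?_⟩
      simp only [e3, h]
      simp
      omega
    · refine ⟨(a + b + c, (b - (a + b + c) / 3, a - 1 - (a + b + c) / 3)), ?_⟩
      simp only [e3, h]
      simp
      omega
    · refine ⟨(a + b + c, (c - (a + b + c) / 3, b - 1 - (a + b + c) / 3)), ?_⟩
      simp only [e3, h]
      simp
      omega
  · rintro ⟨a, i, k⟩
    obtain ⟨t, r, hr, rfl⟩ : ∃ t r : ℤ, (r = 0 ∨ r = 1 ∨ r = 2) ∧ a = 3 * t + r :=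
      ⟨a / 3, a % 3, by omega, by omega⟩
    have q1 : (3 * t + r) / 3 = t := by omega
    have q2 : (3 * t + r) % 3 = r := by omega
    simp only [e3, q1, q2]
    rcases hr with rfl | rfl | rfl <;> simp [wT, wC] <;> ring

/-- the parity bijection -/
def e5 : (ℤ × ℤ) ⊕ ((ℤ × ℤ) ⊕ (ℤ × ℤ)) → (ℤ × ℤ) ⊕ (ℤ × ℤ)
  | Sum.inl (s, r) =>
    if s % 3 = 1 then
      (if (r + s) % 2 = 0 then Sum.inl ((3 * r - s + 1) / 3, (-s - 2 - 3 * r) / 3)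
        else Sum.inr ((3 * r - s + 1) / 3, (-s - 2 - 3 * r) / 3))
    else if s % 3 = 0 then Sum.inr ((-s - 3 * r) / 3, (2 * s) / 3)
    else Sum.inl ((2 * s + 2) / 3, (3 * r - s - 1) / 3)
  | Sum.inr (Sum.inl (i, k)) => Sum.inl (2 * k + 1, 2 * i - 1)
  | Sum.inr (Sum.inr (i, k)) => Sum.inr (2 * k + 1, 2 * i - 1)

lemma f5 : 2 * CC = T 2 2 * T 6 2 + 2 * (X ^ 2 * E (E CC)) := by
  have g1 := good_T 2 2 (by norm_num) (by norm_num) (by norm_num)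
  have g2 := good_T 6 2 (by norm_num) (by norm_num) (by norm_num)
  have gc := good_C
  have gc4 : Good (fun i => 2 * (2 * wC i)) := gc.mono (fun i => by linarith [gc.1 i])
  have gc4' : Good (fun i => 2 * (2 * wC i) + 2) := gc4.mono (fun i => by linarith [gc.1 i])
  have gs : Good (Sum.elim (fun i => 2 * (2 * wC i) + 2) (fun i => 2 * (2 * wC i) + 2)) := by
    refine ⟨?_, fun n => ?_⟩
    · rintro (i | i)
      · exact gc4'.1 i
      · exact gc4'.1 i
    · refine (((gc4'.2 n).image Sum.inl).union ((gc4'.2 n).image Sum.inr)).subset ?_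
      rintro (i | i) hi
      · exact Or.inl ⟨i, hi, rfl⟩
      · exact Or.inr ⟨i, hi, rfl⟩
  unfold T CC
  rw [E_gen, E_gen, two_mul, two_mul, gen_mul g1 g2, gen_shift gc4, gen_add gc gc,
    gen_add gc4' gc4', gen_add (g1.prod g2) gs]
  symm
  refine gen_bij e5 ?_ ?_ ?_
  · rintro (⟨a, a'⟩ | ⟨a, a'⟩ | ⟨a, a'⟩) (⟨b, b'⟩ | ⟨b, b'⟩ | ⟨b, b'⟩) h <;>
      simp only [e5] at h <;> (try split_ifs at h) <;>
      simp only [Sum.inl.injEq, Sum.inr.injEq, Prod.mk.injEq, reduceCtorEq] at h ⊢ <;> omega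
  · rintro (⟨i, k⟩ | ⟨i, k⟩)
    · by_cases hi : i % 2 = 0
      · refine ⟨Sum.inl ((3 * i - 2) / 2, (3 * k + 1 + (3 * i - 2) / 2) / 3), ?_⟩
        simp only [e5]
        rw [if_neg (by omega), if_neg (by omega)]
        simp only [Sum.inl.injEq, Prod.mk.injEq]
        omega
      · by_cases hk : k % 2 = 0
        · refine ⟨Sum.inl ((3 * (-i - k) - 1) / 2, (3 * i - 1 + (3 * (-i - k) - 1) / 2) / 3), ?_⟩
          simp only [e5]
          rw [if_pos (by omega), if_pos (by omega)]
          simp only [Sum.inl.injEq, Prod.mk.injEq]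
          omega
        · refine ⟨Sum.inr (Sum.inl ((k + 1) / 2, (i - 1) / 2)), ?_⟩
          simp only [e5, Sum.inl.injEq, Prod.mk.injEq]
          omega
    · by_cases hk : k % 2 = 0
      · refine ⟨Sum.inl (3 * k / 2, (3 * (-i - k) + 3 * k / 2) / 3), ?_⟩
        simp only [e5]
        rw [if_neg (by omega), if_pos (by omega)]
        simp only [Sum.inr.injEq, Prod.mk.injEq]
        omega
      · by_cases hi : i % 2 = 0
        · refine ⟨Sum.inl ((3 * (-i - k) - 1) / 2, (3 * i - 1 + (3 * (-i - k) - 1) / 2) / 3), ?_⟩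
          simp only [e5]
          rw [if_pos (by omega), if_neg (by omega)]
          simp only [Sum.inr.injEq, Prod.mk.injEq]
          omega
        · refine ⟨Sum.inr (Sum.inr ((k + 1) / 2, (i - 1) / 2)), ?_⟩
          simp only [e5, Sum.inr.injEq, Prod.mk.injEq]
          omega
  · rintro (⟨s, r⟩ | ⟨a, a'⟩ | ⟨a, a'⟩)
    · obtain ⟨t, c, hc, rfl⟩ : ∃ t c : ℤ, (c = 0 ∨ c = 1 ∨ c = 2) ∧ s = 3 * t + c :=
        ⟨s / 3, s % 3, by omega, by omega⟩
      simp only [e5]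
      rcases hc with rfl | rfl | rfl
      · rw [if_neg (by omega), if_pos (by omega),
          (by omega : (-(3 * t + 0) - 3 * r) / 3 = -t - r), (by omega : 2 * (3 * t + 0) / 3 = 2 * t)]
        simp only [wT, wC, Sum.elim_inl, Sum.elim_inr]
        ring
      · rw [if_pos (by omega), (by omega : (3 * r - (3 * t + 1) + 1) / 3 = r - t),
          (by omega : (-(3 * t + 1) - 2 - 3 * r) / 3 = -t - 1 - r)]
        split_ifs <;> simp only [wT, wC, Sum.elim_inl, Sum.elim_inr] <;> ring
      · rw [if_neg (by omega), if_neg (by omega),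
          (by omega : (2 * (3 * t + 2) + 2) / 3 = 2 * t + 2),
          (by omega : (3 * r - (3 * t + 2) - 1) / 3 = r - t - 1)]
        simp only [wT, wC, Sum.elim_inl, Sum.elim_inr]
        ring
    · simp only [e5, wC, Sum.elim_inl, Sum.elim_inr]
      ring
    · simp only [e5, wC, Sum.elim_inl, Sum.elim_inr]
      ring

lemma T_pos (A B : ℤ) (hA : 0 < A) (h1 : B ≤ A) (h2 : -A ≤ B) :
    0 < constantCoeff (T A B) :=
  gen_pos (good_T A B hA h1 h2) 0 (by simp [wT])

lemma T_ne (A B : ℤ) (hA : 0 < A) (h1 : B ≤ A) (h2 : -A ≤ B) : T A B ≠ 0 := by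
  intro h
  have := T_pos A B hA h1 h2
  rw [h] at this
  simp at this

lemma main_T : T 2 0 * (T 2 2 ^ 2 - X ^ 2 * T 6 6 ^ 2) = T 1 1 * T 3 3 * T 6 0 := by
  have e1 := f1 1 (by norm_num)
  norm_num at e1
  have e2 : T 3 3 * T 3 3 = 2 * (T 6 0 * T 6 6) := by
    have h := f1 3 (by norm_num)
    norm_num at h
    exact h
  have e3 := f3
  have i1 : T 1 1 * CC = T 3 3 * T 3 1 * T 3 1 := by
    have h := f4 0 (by norm_num) (by norm_num)
    norm_num at h
    rwa [T_neg, T_neg, T_neg] at h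
  have i2 : T 2 0 * E CC = T 6 4 * T 6 0 * T 6 4 := by
    have h := congrArg E (f4 1 (by norm_num) (by norm_num))
    norm_num [E_T] at h
    rwa [T_neg] at h
  have i3 : T 2 2 * E CC = T 6 6 * T 6 2 * T 6 2 := by
    have h := congrArg E i1
    simpa [E_T] using h
  have e5 := f5
  have e6 := f6
  have nA := T_ne 2 2 (by norm_num) (by norm_num) (by norm_num)
  have nV := T_ne 3 3 (by norm_num) (by norm_num) (by norm_num)
  have nB := T_ne 6 6 (by norm_num) (by norm_num) (by norm_num)
  have nF := T_ne 6 2 (by norm_num) (by norm_num) (by norm_num)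
  have t : 2 * (T 2 2 * T 6 4 * T 6 0) = T 1 1 * T 3 3 * T 6 2 := by
    have p1 := T_pos 2 2 (by norm_num) (by norm_num) (by norm_num)
    have p2 := T_pos 6 4 (by norm_num) (by norm_num) (by norm_num)
    have p3 := T_pos 6 0 (by norm_num) (by norm_num) (by norm_num)
    have p4 := T_pos 1 1 (by norm_num) (by norm_num) (by norm_num)
    have p5 := T_pos 3 3 (by norm_num) (by norm_num) (by norm_num)
    have p6 := T_pos 6 2 (by norm_num) (by norm_num) (by norm_num)
    have ns : 2 * (T 2 2 * T 6 4 * T 6 0) + T 1 1 * T 3 3 * T 6 2 ≠ 0 := by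
      intro h
      have h' := congrArg constantCoeff h
      simp only [map_add, map_mul, map_zero, map_ofNat] at h'
      have : 0 < 2 * (constantCoeff (T 2 2) * constantCoeff (T 6 4) * constantCoeff (T 6 0)) +
        constantCoeff (T 1 1) * constantCoeff (T 3 3) * constantCoeff (T 6 2) := by positivity
      linarith
    refine mul_right_cancel₀ ns ?_
    linear_combination (-4 * T 2 2 ^ 2 * T 6 0) * i2 + (4 * T 2 2 * T 6 0 * T 2 0) * i3
      - T 3 3 ^ 2 * T 6 2 ^ 2 * e1 - 2 * T 2 0 * T 2 2 * T 6 2 ^ 2 * e2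
  have w : T 6 2 * T 6 2 * T 1 1 = T 2 2 * T 6 0 * T 3 1 := by
    refine mul_right_cancel₀ nV ?_
    linear_combination -T 6 2 * t - T 2 2 * T 6 0 * e3
  have r1 : 2 * (E CC * T 1 1) = T 3 3 * T 3 3 * T 3 1 := by
    refine mul_right_cancel₀ nA ?_
    linear_combination 2 * T 1 1 * i3 + 2 * T 6 6 * w - T 2 2 * T 3 1 * e2
  have r2 : 2 * (E (E CC) * T 2 2) = T 6 6 * T 6 6 * T 6 2 := by
    have h := congrArg E r1
    have h2 : E 2 = 2 := map_ofNat E 2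
    simpa [E_T, h2] using h
  have z : T 1 1 * T 6 6 * T 6 2 = T 2 2 * T 3 3 * T 6 4 := by
    refine mul_right_cancel₀ nV ?_
    linear_combination -T 6 6 * t - T 2 2 * T 6 4 * e2
  have z' : 2 * (T 1 1 * E (E CC)) = T 3 3 * T 6 6 * T 6 4 := by
    refine mul_right_cancel₀ nA ?_
    linear_combination T 1 1 * r2 + T 6 6 * z
  have fin1 : T 1 1 * (T 2 2 ^ 2 - X ^ 2 * T 6 6 ^ 2) = 2 * (T 2 2 * T 3 3 * T 6 0) := by
    refine mul_right_cancel₀ nF ?_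
    linear_combination X ^ 2 * T 1 1 * r2 - T 2 2 * T 1 1 * e5 + 2 * T 2 2 * i1
      - 2 * X ^ 2 * T 2 2 * z' + 2 * T 2 2 * T 3 3 * e6
  have n2 : (2 : PowerSeries ℤ) ≠ 0 := by
    intro h0
    have h1 := congrArg constantCoeff h0
    simp only [map_ofNat, map_zero] at h1
    norm_num at h1
  refine mul_right_cancel₀ nA (mul_right_cancel₀ n2 ?_)
  linear_combination -(T 2 2 ^ 2 - X ^ 2 * T 6 6 ^ 2) * e1 + T 1 1 * fin1

end ThetaAux

open ThetaAux in
theorem theta_identity_2_29 :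
    phi 1 * psi 2 ^ 2 = psi 1 * psi 3 * phi 3 + X * phi 1 * psi 6 ^ 2 := by
  apply E_inj
  have h := main_T
  have x1 := phi_eq 2
  have y1 := phi_eq 6
  have u1 := psi_eq 1 (by norm_num)
  have a1 := psi_eq 2 (by norm_num)
  have v1 := psi_eq 3 (by norm_num)
  have b1 := psi_eq 6 (by norm_num)
  norm_num at x1 y1 u1 a1 v1 b1
  rw [← x1, ← y1, ← u1, ← a1, ← v1, ← b1] at h
  simp only [map_add, map_mul, map_pow, E_phi, E_psi, PowerSeries.expand_X]
  norm_num
  have n4 : (4 : PowerSeries ℤ) ≠ 0 := by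
    intro h0
    have h1 := congrArg constantCoeff h0
    simp only [map_ofNat, map_zero] at h1
    norm_num at h1
  refine mul_right_cancel₀ n4 ?_
  linear_combination h
end
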